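/- arXiv:2604.04663 — 3 statements merged into one kernel-verified Lean document; each statement's English description precedes it below -/
import Mathlib

section
/- Let G be a (discrete) group, A a unital C*-algebra, τ a tracial state on A, u : G → A a group homomorphism into the unitary group of A, and Φ : A → A a completely positive linear map. Then the function η : G → ℂ defined by η(g) = τ(Φ(u_g) u_g*) is positive definite on G: for all g_1, …, g_k ∈ G and c_1, …, c_k ∈ ℂ one has Σ_{i,j=1}^k c_i \overline{c_j} η(g_j^{-1} g_i) ≥ 0 (in particular this sum is a nonnegative real number). (This is the global-action form of the positive-definiteness computation in the proof of Theorem 3.7, implication (1)⇒(2), of the paper.) -/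
open scoped ComplexOrder Matrix

/-- A linear map `Φ : A → B` between complex `*`-algebras is *completely positive* if
for every `n` its entrywise extension to `n × n` matrices maps positive elements
(elements of the form `yᴴ * y`) to positive elements. -/
def IsCPMap {A B : Type*} [Ring A] [StarRing A] [Module ℂ A]
    [Ring B] [StarRing B] [Module ℂ B] (Φ : A →ₗ[ℂ] B) : Prop :=
  ∀ (n : ℕ) (M : Matrix (Fin n) (Fin n) A),
    (∃ y : Matrix (Fin n) (Fin n) A, M = yᴴ * y) →
    ∃ z : Matrix (Fin n) (Fin n) B, M.map ⇑Φ = zᴴ * z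

/-- Let `G` be a discrete group, `A` a unital C*-algebra, `τ` a
tracial state on `A`, `u : G → A` a group homomorphism into the unitary group of `A`,
and `Φ : A → A` a completely positive linear map.  Then the function
`η g = τ(Φ(u g) (u g)*)` is positive definite on `G`:
`∑_{i,j} c i * conj (c j) * η ((g j)⁻¹ * g i) ≥ 0`. -/
theorem ucp_matrix_coefficient_posDef
    {G : Type*} [Group G]
    {A : Type*} [NormedRing A] [StarRing A] [CStarRing A]
    [NormedAlgebra ℂ A] [StarModule ℂ A] [CompleteSpace A]
    (τ : A →ₗ[ℂ] ℂ)
    (hτ1 : τ 1 = 1)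
    (hτpos : ∀ a : A, 0 ≤ τ (star a * a))
    (hτtr : ∀ a b : A, τ (a * b) = τ (b * a))
    (u : G →* unitary A)
    (Φ : A →ₗ[ℂ] A) (hΦ : IsCPMap Φ)
    (η : G → ℂ) (hη : ∀ g : G, η g = τ (Φ ((u g : A)) * star ((u g : A))))
    (k : ℕ) (g : Fin k → G) (c : Fin k → ℂ) :
    0 ≤ ∑ i : Fin k, ∑ j : Fin k,
        c i * (starRingEnd ℂ) (c j) * η ((g j)⁻¹ * g i) := by
  rcases Nat.eq_zero_or_pos k with rfl | hk
  · simp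
  obtain ⟨z, hz⟩ := hΦ k (Matrix.of fun j i => star (u (g j) : A) * (u (g i) : A))
    ⟨Matrix.of fun l i => if l = ⟨0, hk⟩ then (u (g i) : A) else 0, by
      ext j i
      simp [Matrix.mul_apply, Matrix.conjTranspose_apply, apply_ite star]⟩
  have hΦz (j i : Fin k) :
      Φ (star (u (g j) : A) * (u (g i) : A)) = ∑ l, star (z l j) * z l i := by
    simpa [Matrix.mul_apply, Matrix.conjTranspose_apply] using congrFun (congrFun hz j) i
  have hu (j i : Fin k) :
      (u ((g j)⁻¹ * g i) : A) = star (u (g j) : A) * (u (g i) : A) := by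
    rw [map_mul, map_inv, ← Unitary.star_eq_inv]
    simp
  have hηz (j i : Fin k) : η ((g j)⁻¹ * g i) =
      ∑ l, τ (star (z l j * star (u (g j) : A)) * (z l i * star (u (g i) : A))) := by
    rw [hη, hu, hΦz, Finset.sum_mul, map_sum]
    refine Finset.sum_congr rfl fun l _ => ?_
    rw [star_mul, star_mul, star_star, ← mul_assoc, hτtr, ← mul_assoc]
    simp only [mul_assoc]
  have hsum : ∑ i : Fin k, ∑ j : Fin k, c i * (starRingEnd ℂ) (c j) * η ((g j)⁻¹ * g i) =
      ∑ l, τ (star (∑ j, c j • (z l j * star (u (g j) : A))) *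
        ∑ i, c i • (z l i * star (u (g i) : A))) := by
    simp_rw [hηz, star_sum, Finset.sum_mul_sum, map_sum, Finset.mul_sum]
    rw [Finset.sum_comm]
    conv_rhs => rw [Finset.sum_comm]
    refine Finset.sum_congr rfl fun j _ => ?_
    rw [Finset.sum_comm]
    refine Finset.sum_congr rfl fun l _ => Finset.sum_congr rfl fun i _ => ?_
    rw [star_smul, smul_mul_smul_comm, map_smul, smul_eq_mul, mul_comm (c i)]
    rfl
  rw [hsum]
  exact Finset.sum_nonneg fun l _ => hτpos _
end

section
/- Let B be a unital C*-algebra with a faithful tracial state τ̃, let A ⊆ B be a C*-subalgebra containing the unit of B, and let E : B → A be a unital completely positive map satisfying E(a) = a for every a ∈ A and τ̃(E(b)) = τ̃(b) for every b ∈ B. Let τ denote the restriction of τ̃ to A (a faithful tracial state on A). If (B, τ̃) has the Haagerup property, then (A, τ) has the Haagerup property. (This is the abstract form of Lemma 3.6 of the paper, where B is the reduced partial crossed product A⋊_{α,r}G, E is the canonical conditional expectation of Equation (2.1), and τ̃ = τ∘E.) -/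
open scoped ComplexOrder Matrix

/-- The GNS seminorm `‖a‖_{2,τ} = τ(a* a)^{1/2}` associated to a positive linear
functional `τ`. -/
noncomputable def l2norm {A : Type*} [Ring A] [StarRing A] [Module ℂ A]
    (τ : A →ₗ[ℂ] ℂ) (a : A) : ℝ :=
  Real.sqrt (τ (star a * a)).re

/-- A *unital completely positive* (u.c.p.) map. -/
def IsUCP {A B : Type*} [Ring A] [StarRing A] [Module ℂ A]
    [Ring B] [StarRing B] [Module ℂ B] (Φ : A →ₗ[ℂ] B) : Prop :=
  IsCPMap Φ ∧ Φ 1 = 1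

/-- `Φ` is `τ`-decreasing: `τ(Φ a) ≤ τ a` for every positive element `a`. -/
def TauDecreasing {A : Type*} [Ring A] [StarRing A] [Module ℂ A]
    (τ : A →ₗ[ℂ] ℂ) (Φ : A →ₗ[ℂ] A) : Prop :=
  ∀ a : A, (∃ y : A, a = star y * y) → τ (Φ a) ≤ τ a

/-- `Φ` is `L₂`-compact with respect to `τ`: for every `ε > 0` there is a linear map
with finite-dimensional range approximating `Φ` within `ε` in the `‖·‖_{2,τ}`-sense. -/
def L2Compact {A : Type*} [Ring A] [StarRing A] [Module ℂ A]
    (τ : A →ₗ[ℂ] ℂ) (Φ : A →ₗ[ℂ] A) : Prop :=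
  ∀ ε : ℝ, 0 < ε → ∃ R : A →ₗ[ℂ] A, FiniteDimensional ℂ (LinearMap.range R) ∧
    ∀ a : A, l2norm τ (Φ a - R a) ≤ ε * l2norm τ a

/-- The pair `(A, τ)` has the *Haagerup property* if there is a sequence of
`τ`-decreasing, `L₂`-compact u.c.p. maps on `A` converging pointwise to the identity
in `‖·‖_{2,τ}`. -/
def HasHaagerup (A : Type*) [Ring A] [StarRing A] [Module ℂ A]
    (τ : A →ₗ[ℂ] ℂ) : Prop :=
  ∃ Φ : ℕ → A →ₗ[ℂ] A,
    (∀ n, IsUCP (Φ n) ∧ TauDecreasing τ (Φ n) ∧ L2Compact τ (Φ n)) ∧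
    ∀ a : A, Filter.Tendsto (fun n => l2norm τ (Φ n a - a)) Filter.atTop (nhds 0)

theorem IsCPMap.comp {A B C : Type*} [Ring A] [StarRing A] [Module ℂ A]
    [Ring B] [StarRing B] [Module ℂ B] [Ring C] [StarRing C] [Module ℂ C]
    {Ψ : B →ₗ[ℂ] C} {Φ : A →ₗ[ℂ] B} (hΨ : IsCPMap Ψ) (hΦ : IsCPMap Φ) :
    IsCPMap (Ψ ∘ₗ Φ) := by
  intro n M hM
  obtain ⟨z, hz⟩ := hΨ n (M.map Φ) (hΦ n M hM)
  exact ⟨z, by rw [← hz, Matrix.map_map, LinearMap.coe_comp]⟩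

theorem IsUCP.comp {A B C : Type*} [Ring A] [StarRing A] [Module ℂ A]
    [Ring B] [StarRing B] [Module ℂ B] [Ring C] [StarRing C] [Module ℂ C]
    {Ψ : B →ₗ[ℂ] C} {Φ : A →ₗ[ℂ] B} (hΨ : IsUCP Ψ) (hΦ : IsUCP Φ) :
    IsUCP (Ψ ∘ₗ Φ) :=
  ⟨hΨ.1.comp hΦ.1, by rw [LinearMap.comp_apply, hΦ.2, hΨ.2]⟩

/-- A unital `*`-homomorphism is a u.c.p. map. -/
theorem StarAlgHom.isUCP {A B : Type*} [Ring A] [StarRing A] [Algebra ℂ A]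
    [Ring B] [StarRing B] [Algebra ℂ B] (f : A →⋆ₐ[ℂ] B) :
    IsUCP f.toAlgHom.toLinearMap := by
  refine ⟨?_, map_one f⟩
  rintro n _ ⟨y, rfl⟩
  refine ⟨y.map f, ?_⟩
  ext i j
  simp [Matrix.mul_apply, map_sum, map_mul, map_star]

/-- The Kadison-Schwarz inequality: `Φ (b* b) - Φ(b)* Φ(b)` is a sum of squares. -/
theorem IsUCP.exists_kadison_schwarz {A B : Type*} [Ring A] [StarRing A] [Module ℂ A]
    [Ring B] [StarRing B] [Module ℂ B] {Φ : A →ₗ[ℂ] B} (hΦ : IsUCP Φ) (b : A) :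
    ∃ w : Fin 2 → B, Φ (star b * b) = star (Φ b) * Φ b + ∑ k, star (w k) * w k := by
  obtain ⟨z, hz⟩ := hΦ.1 2 _ ⟨!![1, b; 0, 0], rfl⟩
  have h00 := congrFun (congrFun hz 0) 0
  have h01 := congrFun (congrFun hz 0) 1
  have h10 := congrFun (congrFun hz 1) 0
  have h11 := congrFun (congrFun hz 1) 1
  simp [Matrix.mul_apply, Fin.sum_univ_two, hΦ.2] at h00 h01 h10 h11
  have hs : star (z 0 1) * z 0 0 + star (z 1 1) * z 1 0 = star (Φ b) := by
    rw [h01]; simp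
  refine ⟨fun k => z k 1 - z k 0 * Φ b, ?_⟩
  have expand : ∑ k, star (z k 1 - z k 0 * Φ b) * (z k 1 - z k 0 * Φ b) =
      (star (z 0 1) * z 0 1 + star (z 1 1) * z 1 1)
      - (star (z 0 1) * z 0 0 + star (z 1 1) * z 1 0) * Φ b
      - star (Φ b) * (star (z 0 0) * z 0 1 + star (z 1 0) * z 1 1)
      + star (Φ b) * (star (z 0 0) * z 0 0 + star (z 1 0) * z 1 0) * Φ b := by
    simp only [Fin.sum_univ_two, star_sub, star_mul]
    noncomm_ring
  rw [expand, ← h11, ← h01, ← h00, hs]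
  noncomm_ring

/-- A u.c.p. map intertwining positive functionals is contractive for the GNS seminorms. -/
theorem IsUCP.l2norm_le {A B : Type*} [Ring A] [StarRing A] [Module ℂ A]
    [Ring B] [StarRing B] [Module ℂ B] {Φ : A →ₗ[ℂ] B} (hΦ : IsUCP Φ)
    {σ : A →ₗ[ℂ] ℂ} {τ : B →ₗ[ℂ] ℂ} (hτ : ∀ b : B, 0 ≤ τ (star b * b))
    (h : ∀ a, τ (Φ a) = σ a) (a : A) : l2norm τ (Φ a) ≤ l2norm σ a := by
  obtain ⟨w, hw⟩ := hΦ.exists_kadison_schwarz a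
  refine Real.sqrt_le_sqrt (Complex.le_def.1 ?_).1
  rw [← h, hw, map_add, map_sum]
  exact le_add_of_nonneg_right (Finset.sum_nonneg fun k _ => hτ (w k))

/-- Let `B` be a unital C*-algebra with a faithful tracial state `τ̃`,
`A ⊆ B` a C*-subalgebra containing the unit of `B`, and `E : B → A` a unital completely
positive map with `E(a) = a` for `a ∈ A` and `τ̃(E(b)) = τ̃(b)` for all `b ∈ B`.  Let `τ`
be the restriction of `τ̃` to `A`.  If `(B, τ̃)` has the Haagerup property, then `(A, τ)`
has the Haagerup property. -/
theorem haagerup_of_conditional_expectation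
    {B : Type*} [NormedRing B] [StarRing B] [CStarRing B]
    [NormedAlgebra ℂ B] [StarModule ℂ B] [CompleteSpace B]
    (τ : B →ₗ[ℂ] ℂ)
    (hτ1 : τ 1 = 1)
    (hτpos : ∀ b : B, 0 ≤ τ (star b * b))
    (hτtr : ∀ a b : B, τ (a * b) = τ (b * a))
    (hτfaithful : ∀ b : B, τ (star b * b) = 0 → b = 0)
    (A : StarSubalgebra ℂ B) (hA : IsClosed (A : Set B))
    (E : B →ₗ[ℂ] ↥A) (hE : IsUCP E)
    (hEfix : ∀ a : ↥A, E (a : B) = a)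
    (hEτ : ∀ b : B, τ ((E b : B)) = τ b)
    (hHB : HasHaagerup B τ) :
    HasHaagerup ↥A (τ ∘ₗ A.subtype.toAlgHom.toLinearMap) := by
  obtain ⟨Φ, hΦ, hlim⟩ := hHB
  set ι : ↥A →ₗ[ℂ] B := A.subtype.toAlgHom.toLinearMap with hι
  have hιUCP : IsUCP ι := A.subtype.isUCP
  have hcontr : ∀ b : B, l2norm (τ ∘ₗ ι) (E b) ≤ l2norm τ b :=
    hE.l2norm_le (fun a => hτpos (a : B)) hEτ
  refine ⟨fun n => E ∘ₗ Φ n ∘ₗ ι, fun n => ?_, fun a => ?_⟩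
  · obtain ⟨hUCP, hdec, hcpt⟩ := hΦ n
    refine ⟨hE.comp (hUCP.comp hιUCP), ?_, fun ε hε => ?_⟩
    · rintro _ ⟨y, rfl⟩
      exact (hEτ _).trans_le (hdec _ ⟨(y : B), rfl⟩)
    · obtain ⟨R, hR, hRle⟩ := hcpt ε hε
      refine ⟨E ∘ₗ R ∘ₗ ι, ?_, fun a => ?_⟩
      · rw [LinearMap.range_comp]
        have : FiniteDimensional ℂ (LinearMap.range (R ∘ₗ ι)) :=
          Submodule.finiteDimensional_of_le (LinearMap.range_comp_le_range ι R)
        infer_instance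
      · simp only [LinearMap.comp_apply, ← map_sub]
        exact (hcontr _).trans (hRle (a : B))
  · refine squeeze_zero (fun n => Real.sqrt_nonneg _) (fun n => ?_) (hlim (a : B))
    have : (E ∘ₗ Φ n ∘ₗ ι) a - a = E (Φ n a - a) := by
      rw [map_sub, hEfix]; rfl
    rw [this]
    exact hcontr _
end

section
/- Let G be a discrete group and let B be a unital C*-algebra with a faithful tracial state τ̃ such that (B, τ̃) has the Haagerup property. Suppose u : G → B is a group homomorphism into the unitary group of B satisfying τ̃(u_g) = 0 for every g ≠ e. Then the group G has the Haagerup property: indeed, if (Φ_n) is a sequence of τ̃-decreasing L₂-compact unital completely positive maps on B with ‖Φ_n(b) − b‖_{2,τ̃} → 0 for every b ∈ B, then the functions η_n : G → ℂ, η_n(g) = τ̃(Φ_n(u_g) u_g*), are positive definite, satisfy η_n(e) = 1, vanish at infinity, and converge pointwise to 1. (This is the global-action form of the implication (1)⇒(2) of Theorem 3.7 of the paper, which deduces the Haagerup property of G from that of the reduced partial crossed product.) -/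
open scoped ComplexOrder Matrix

/-- A function `η : G → ℂ` on a discrete group is *positive definite* if all the
matrices `(η ((g j)⁻¹ * g i))_{i,j}` yield nonnegative quadratic forms. -/
def IsPosDefFn {G : Type*} [Group G] (η : G → ℂ) : Prop :=
  ∀ (k : ℕ) (g : Fin k → G) (c : Fin k → ℂ),
    0 ≤ ∑ i : Fin k, ∑ j : Fin k,
      c i * (starRingEnd ℂ) (c j) * η ((g j)⁻¹ * g i)

/-- A function `η : G → ℂ` *vanishes at infinity* if for every `ε > 0` the set
`{g | |η g| ≥ ε}` is finite. -/
def VanishesAtInfinity {G : Type*} (η : G → ℂ) : Prop :=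
  ∀ ε : ℝ, 0 < ε → {g : G | ε ≤ ‖η g‖}.Finite

/-- A discrete group `G` has the *Haagerup property* if there is a sequence of
positive definite functions on `G` vanishing at infinity, normalized at the identity,
and converging pointwise to `1`. -/
def GroupHasHaagerup (G : Type*) [Group G] : Prop :=
  ∃ η : ℕ → G → ℂ,
    (∀ n, IsPosDefFn (η n) ∧ η n 1 = 1 ∧ VanishesAtInfinity (η n)) ∧
    ∀ g : G, Filter.Tendsto (fun n => η n g) Filter.atTop (nhds 1)

/-- A positive functional on a complex `*`-algebra is hermitian on products `a* b`. -/
theorem conj_apply_star_mul {B : Type*} [Ring B] [StarRing B] [Algebra ℂ B] [StarModule ℂ B]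
    {τ : B →ₗ[ℂ] ℂ} (hτpos : ∀ b : B, 0 ≤ τ (star b * b)) (a b : B) :
    (starRingEnd ℂ) (τ (star b * a)) = τ (star a * b) := by
  have him (x : B) : (τ (star x * x)).im = 0 := (Complex.nonneg_iff.1 (hτpos x)).2.symm
  have h₁ := him (a + b)
  have h₂ := him (a + Complex.I • b)
  simp only [star_add, star_smul, add_mul, mul_add, map_add, smul_mul_assoc, mul_smul_comm,
    map_smul, Complex.add_im, him, smul_eq_mul, Complex.mul_im, Complex.mul_re,
    Complex.star_def, Complex.conj_I, Complex.neg_re, Complex.neg_im, Complex.I_re,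
    Complex.I_im] at h₁ h₂
  apply Complex.ext
  · simp only [Complex.conj_re]
    linarith
  · simp only [Complex.conj_im]
    linarith

/-- A faithful positive functional `τ` gives a linear map into an inner product space whose
inner product is `τ (a* b)`. -/
theorem exists_innerProductSpace_of_faithful.{v} {B : Type v} [Ring B] [StarRing B] [Algebra ℂ B]
    [StarModule ℂ B] {τ : B →ₗ[ℂ] ℂ} (hτpos : ∀ b : B, 0 ≤ τ (star b * b))
    (hτfaithful : ∀ b : B, τ (star b * b) = 0 → b = 0) :
    ∃ (H : Type v) (_ : NormedAddCommGroup H) (_ : InnerProductSpace ℂ H) (ι : B →ₗ[ℂ] H),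
      ∀ a b : B, inner ℂ (ι a) (ι b) = τ (star a * b) := by
  let c : InnerProductSpace.Core ℂ B :=
    { inner := fun a b => τ (star a * b)
      conj_inner_symm := fun a b => conj_apply_star_mul hτpos a b
      re_inner_nonneg := fun a => (Complex.nonneg_iff.1 (hτpos a)).1
      add_left := fun a b d => by simp [add_mul]
      smul_left := fun a b r => by simp
      definite := fun a h => hτfaithful a h }
  exact ⟨B, c.toNormedAddCommGroup, InnerProductSpace.ofCore c.toCore, LinearMap.id,
    fun _ _ => rfl⟩

/-- Against a bounded family in a finite-dimensional subspace, an orthonormal family tends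
weakly to zero along the cofinite filter. -/
theorem Orthonormal.tendsto_inner_cofinite_zero {H G : Type*} [NormedAddCommGroup H]
    [InnerProductSpace ℂ H] {e x : G → H} (he : Orthonormal ℂ e) {V : Submodule ℂ H}
    [FiniteDimensional ℂ V] (hxV : ∀ g, x g ∈ V) {C : ℝ} (hxC : ∀ g, ‖x g‖ ≤ C) :
    Filter.Tendsto (fun g => inner ℂ (e g) (x g)) Filter.cofinite (nhds 0) := by
  let b := stdOrthonormalBasis ℂ V
  have hb (i) : Filter.Tendsto (fun g => ‖inner ℂ (e g) (b i : H)‖) Filter.cofinite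
      (nhds 0) := by
    have h := (he.inner_products_summable (x := (b i : H))).tendsto_cofinite_zero
    simpa using h.sqrt
  have hsum : Filter.Tendsto (fun g => ∑ i, C * ‖inner ℂ (e g) (b i : H)‖) Filter.cofinite
      (nhds 0) := by
    simpa using tendsto_finsetSum Finset.univ fun i _ => (hb i).const_mul C
  refine squeeze_zero_norm (fun g => ?_) hsum
  have hx : x g = ∑ i, inner ℂ (b i) (⟨x g, hxV g⟩ : V) • (b i : H) := by
    simpa using (congrArg V.subtype (b.sum_repr' ⟨x g, hxV g⟩)).symm
  conv_lhs => rw [hx, inner_sum]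
  refine (norm_sum_le _ _).trans (Finset.sum_le_sum fun i _ => ?_)
  rw [inner_smul_right, norm_mul]
  gcongr
  refine (norm_inner_le_norm _ _).trans ?_
  rw [b.norm_eq_one, one_mul]
  exact hxC g

/-- The Schwarz inequality at a unitary, integrated against a positive functional. -/
theorem IsUCP.apply_star_mul_self_le_one {B : Type*} [Ring B] [StarRing B] [Algebra ℂ B]
    {τ : B →ₗ[ℂ] ℂ} (hτ1 : τ 1 = 1) (hτpos : ∀ b : B, 0 ≤ τ (star b * b))
    {Φ : B →ₗ[ℂ] B} (hΦ : IsUCP Φ) (v : unitary B) :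
    τ (star (Φ (v : B)) * Φ (v : B)) ≤ 1 := by
  obtain ⟨z, hz⟩ := hΦ.1 2 _ ⟨!![1, (v : B); 0, 0], rfl⟩
  have hM (i j) := congrFun (congrFun hz i) j
  have h00 := hM 0 0
  have h01 := hM 0 1
  have h10 := hM 1 0
  have h11 := hM 1 1
  simp [Matrix.mul_apply, Fin.sum_univ_two, hΦ.2] at h00 h01 h10 h11
  set a := Φ (v : B)
  have h10' : Φ (star (v : B)) = star a := by
    rw [h10, h01]
    simp
  rw [h10'] at h10
  have key : star (z 0 1 - z 0 0 * a) * (z 0 1 - z 0 0 * a) +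
      star (z 1 1 - z 1 0 * a) * (z 1 1 - z 1 0 * a) = 1 - star a * a := by
    calc _ = (star (z 0 1) * z 0 1 + star (z 1 1) * z 1 1)
          - (star (z 0 1) * z 0 0 + star (z 1 1) * z 1 0) * a
          - star a * (star (z 0 0) * z 0 1 + star (z 1 0) * z 1 1)
          + star a * (star (z 0 0) * z 0 0 + star (z 1 0) * z 1 0) * a := by
            simp only [star_sub, star_mul]
            noncomm_ring
      _ = _ := by
            rw [← h00, ← h01, ← h10, ← h11]
            noncomm_ring
  have h := add_nonneg (hτpos (z 0 1 - z 0 0 * a)) (hτpos (z 1 1 - z 1 0 * a))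
  rw [← map_add, key, map_sub, hτ1] at h
  exact sub_nonneg.1 h

/-- The coefficient of a completely positive map along a unitary representation is positive
definite. -/
theorem IsCPMap.isPosDefFn {G : Type*} [Group G] {B : Type*} [Ring B] [StarRing B]
    [Algebra ℂ B] [StarModule ℂ B] {τ : B →ₗ[ℂ] ℂ} (hτpos : ∀ b : B, 0 ≤ τ (star b * b))
    (hτtr : ∀ a b : B, τ (a * b) = τ (b * a)) {Φ : B →ₗ[ℂ] B} (hΦ : IsCPMap Φ)
    (u : G →* unitary B) :
    IsPosDefFn (fun g : G => τ (Φ (u g : B) * star (u g : B))) := by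
  intro k g c
  rcases k with _ | k
  · simp
  obtain ⟨z, hz⟩ := hΦ (k + 1) _
    ⟨Matrix.of fun l i => if l = 0 then (u (g i) : B) else 0, rfl⟩
  have hM (i j) : Φ (star (u (g j) : B) * (u (g i) : B)) = ∑ l, star (z l j) * z l i := by
    simpa [Matrix.mul_apply, apply_ite star] using congrFun (congrFun hz j) i
  have hu (i j) : (u ((g j)⁻¹ * g i) : B) = star (u (g j) : B) * (u (g i) : B) := by
    rw [map_mul, map_inv]
    rfl
  let w (l : Fin (k + 1)) : B := ∑ i, c i • (z l i * star (u (g i) : B))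
  have key : ∑ i, ∑ j, c i * (starRingEnd ℂ) (c j) *
      τ (Φ (u ((g j)⁻¹ * g i) : B) * star (u ((g j)⁻¹ * g i) : B)) =
      ∑ l, τ (star (w l) * w l) := by
    have hw (l) : τ (star (w l) * w l) = ∑ i, ∑ j, c i * (starRingEnd ℂ) (c j) *
        τ (star (z l j) * z l i * (star (u (g i) : B) * (u (g j) : B))) := by
      simp only [w, star_sum, Finset.sum_mul_sum, map_sum]
      rw [Finset.sum_comm]
      refine Finset.sum_congr rfl fun i _ => Finset.sum_congr rfl fun j _ => ?_
      rw [star_smul, star_mul, star_star, smul_mul_smul_comm, map_smul, smul_eq_mul,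
        mul_assoc (u (g j) : B), hτtr, mul_comm (c i)]
      simp only [mul_assoc, Complex.star_def]
    simp only [hw, hu, hM, star_mul, star_star, Finset.sum_mul, map_sum, Finset.mul_sum]
    conv_rhs => rw [Finset.sum_comm]
    refine Finset.sum_congr rfl fun i _ => ?_
    rw [Finset.sum_comm]
  rw [key]
  exact Finset.sum_nonneg fun l _ => hτpos _

/-- Let `G` be a discrete group and `B` a unital C*-algebra with a
faithful tracial state `τ` such that `(B, τ)` has the Haagerup property.  Suppose
`u : G → B` is a group homomorphism into the unitary group of `B` with `τ(u g) = 0` for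
every `g ≠ e`.  Then `G` has the Haagerup property; indeed, for every sequence `(Φ n)`
of `τ`-decreasing `L₂`-compact u.c.p. maps on `B` with `‖Φ n b − b‖_{2,τ} → 0` for every
`b`, the functions `η n g = τ(Φ n (u g) * (u g)*)` are positive definite, satisfy
`η n e = 1`, vanish at infinity, and converge pointwise to `1`. -/
theorem group_haagerup_of_algebra_haagerup
    {G : Type*} [Group G]
    {B : Type*} [NormedRing B] [StarRing B] [CStarRing B]
    [NormedAlgebra ℂ B] [StarModule ℂ B] [CompleteSpace B]
    (τ : B →ₗ[ℂ] ℂ)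
    (hτ1 : τ 1 = 1)
    (hτpos : ∀ b : B, 0 ≤ τ (star b * b))
    (hτtr : ∀ a b : B, τ (a * b) = τ (b * a))
    (hτfaithful : ∀ b : B, τ (star b * b) = 0 → b = 0)
    (u : G →* unitary B)
    (hu : ∀ g : G, g ≠ 1 → τ ((u g : B)) = 0)
    (hHB : HasHaagerup B τ) :
    GroupHasHaagerup G ∧
      ∀ Φ : ℕ → B →ₗ[ℂ] B,
        (∀ n, IsUCP (Φ n) ∧ TauDecreasing τ (Φ n) ∧ L2Compact τ (Φ n)) →
        (∀ b : B, Filter.Tendsto (fun n => l2norm τ (Φ n b - b))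
          Filter.atTop (nhds 0)) →
        (∀ n, IsPosDefFn (fun g : G => τ (Φ n (u g : B) * star ((u g : B)))) ∧
            τ (Φ n ((u (1 : G) : B)) * star ((u (1 : G) : B))) = 1 ∧
            VanishesAtInfinity (fun g : G => τ (Φ n (u g : B) * star ((u g : B))))) ∧
          ∀ g : G, Filter.Tendsto (fun n => τ (Φ n (u g : B) * star ((u g : B))))
            Filter.atTop (nhds 1) := by
  have main : ∀ Φ : ℕ → B →ₗ[ℂ] B,
      (∀ n, IsUCP (Φ n) ∧ TauDecreasing τ (Φ n) ∧ L2Compact τ (Φ n)) →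
      (∀ b : B, Filter.Tendsto (fun n => l2norm τ (Φ n b - b)) Filter.atTop (nhds 0)) →
      (∀ n, IsPosDefFn (fun g : G => τ (Φ n (u g : B) * star ((u g : B)))) ∧
          τ (Φ n ((u (1 : G) : B)) * star ((u (1 : G) : B))) = 1 ∧
          VanishesAtInfinity (fun g : G => τ (Φ n (u g : B) * star ((u g : B))))) ∧
        ∀ g : G, Filter.Tendsto (fun n => τ (Φ n (u g : B) * star ((u g : B))))
          Filter.atTop (nhds 1) := by
    intro Φ hΦ hlim
    obtain ⟨H, _, _, ι, hι⟩ := exists_innerProductSpace_of_faithful hτpos hτfaithful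
    have hnorm (a : B) : l2norm τ a = ‖ι a‖ := by
      rw [norm_eq_sqrt_re_inner (𝕜 := ℂ), hι]
      rfl
    have hη (Ψ : B →ₗ[ℂ] B) (g : G) :
        τ (Ψ (u g : B) * star (u g : B)) = inner ℂ (ι (u g : B)) (ι (Ψ (u g : B))) := by
      rw [hι, hτtr]
    have horth : Orthonormal ℂ fun g => ι (u g : B) := by
      classical
      rw [orthonormal_iff_ite]
      intro g h
      have hgh : star (u g : B) * (u h : B) = (u (g⁻¹ * h) : B) := by
        rw [map_mul, map_inv]
        rfl
      rw [hι, hgh]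
      split_ifs with heq
      · simp [heq, hτ1]
      · exact hu _ fun h1 => heq (inv_mul_eq_one.1 h1)
    have hone (g : G) : ‖ι (u g : B)‖ = 1 := horth.1 g
    refine ⟨fun n => ⟨(hΦ n).1.1.isPosDefFn hτpos hτtr u, ?_, ?_⟩, fun g => ?_⟩
    · simp [(hΦ n).1.2, hτ1]
    · intro ε hε
      obtain ⟨R, hR, hRΦ⟩ := (hΦ n).2.2 (ε / 2) (half_pos hε)
      have hdist (g : G) : ‖ι (Φ n (u g : B)) - ι (R (u g : B))‖ ≤ ε / 2 := by
        have h := hRΦ (u g : B)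
        rwa [hnorm, hnorm, hone, mul_one, map_sub] at h
      have hΦ1 (g : G) : ‖ι (Φ n (u g : B))‖ ≤ 1 := by
        rw [← hnorm, l2norm, Real.sqrt_le_one]
        exact (Complex.le_def.1 ((hΦ n).1.apply_star_mul_self_le_one hτ1 hτpos (u g))).1
      have hRbd (g : G) : ‖ι (R (u g : B))‖ ≤ ε / 2 + 1 := by
        refine (norm_le_norm_sub_add _ (ι (Φ n (u g : B)))).trans ?_
        rw [norm_sub_rev]
        exact add_le_add (hdist g) (hΦ1 g)
      have ht := horth.tendsto_inner_cofinite_zero (V := (LinearMap.range R).map ι)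
        (fun g => Submodule.mem_map_of_mem (LinearMap.mem_range_self R (u g : B))) hRbd
      have hev := ht.norm.eventually_lt_const (u := ε / 2) (by simpa using half_pos hε)
      refine Set.Finite.subset (Filter.eventually_cofinite.1 hev) fun g hg hlt => ?_
      replace hg : ε ≤ ‖τ (Φ n (u g : B) * star (u g : B))‖ := hg
      rw [hη] at hg
      have h1 : ‖inner ℂ (ι (u g : B)) (ι (Φ n (u g : B)) - ι (R (u g : B)))‖ ≤ ε / 2 := by
        refine (norm_inner_le_norm _ _).trans ?_
        rw [hone, one_mul]
        exact hdist g
      rw [inner_sub_right] at h1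
      have h2 := norm_le_norm_sub_add (inner ℂ (ι (u g : B)) (ι (Φ n (u g : B))))
        (inner ℂ (ι (u g : B)) (ι (R (u g : B))))
      linarith
    · rw [tendsto_iff_norm_sub_tendsto_zero]
      refine squeeze_zero (fun _ => norm_nonneg _) (fun n => ?_) (hlim (u g : B))
      have h1 : inner ℂ (ι (u g : B)) (ι (u g : B)) = (1 : ℂ) := by
        rw [inner_self_eq_norm_sq_to_K, hone]
        simp
      rw [hη, ← h1, ← inner_sub_right, ← map_sub, hnorm]
      refine (norm_inner_le_norm _ _).trans ?_
      rw [hone, one_mul]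
  obtain ⟨Φ, hΦ, hlim⟩ := hHB
  exact ⟨⟨_, main Φ hΦ hlim⟩, main⟩
end
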